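/- Let G be a group, a ∈ G, and ε : G → ℤ a group homomorphism with ε(a) = 1. Then for every g ∈ C_G(a) there exists g' ∈ C_G(a) ∩ Ker ε and n ∈ ℤ with g = g' aⁿ, and the homology classes in H₂G satisfy cls([a|g] − [g|a]) = cls([a|g'] − [g'|a]). -/

import Mathlib

open Finsupp

noncomputable section

universe u

/-- Degree-2 differential of the (unnormalized) inhomogeneous bar complex of `G`
with trivial `ℤ` coefficients: `[g|h] ↦ [h] - [gh] + [g]`. -/
def d2 (G : Type*) [Group G] : ((G × G) →₀ ℤ) →ₗ[ℤ] (G →₀ ℤ) :=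
  Finsupp.lift _ ℤ _ fun p => single p.2 1 - single (p.1 * p.2) 1 + single p.1 1

/-- Degree-3 differential: `[g|h|k] ↦ [h|k] - [gh|k] + [g|hk] - [g|h]`. -/
def d3 (G : Type*) [Group G] : ((G × G × G) →₀ ℤ) →ₗ[ℤ] ((G × G) →₀ ℤ) :=
  Finsupp.lift _ ℤ _ fun t =>
    single (t.2.1, t.2.2) 1 - single (t.1 * t.2.1, t.2.2) 1 +
      single (t.1, t.2.1 * t.2.2) 1 - single (t.1, t.2.1) 1

/-- 2-cycles. -/
def Z2 (G : Type*) [Group G] : Submodule ℤ ((G × G) →₀ ℤ) := LinearMap.ker (d2 G)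

/-- 2-boundaries, as a submodule of the 2-cycles. -/
def B2 (G : Type*) [Group G] : Submodule ℤ (Z2 G) :=
  (LinearMap.range (d3 G)).comap (Z2 G).subtype

/-- The second integral homology of `G`, defined via the inhomogeneous bar complex. -/
abbrev H2 (G : Type*) [Group G] := Z2 G ⧸ B2 G

/-- The homology class of a 2-cycle. -/
def H2cls (G : Type*) [Group G] (z : (G × G) →₀ ℤ) (hz : z ∈ Z2 G) : H2 G :=
  Submodule.Quotient.mk ⟨z, hz⟩

/-- The bar 2-chain `[a|g] - [g|a]`. -/
def barChain (G : Type*) [Group G] (a g : G) : (G × G) →₀ ℤ :=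
  single (a, g) 1 - single (g, a) 1

theorem barChain_mem (G : Type*) [Group G] (a g : G) (h : a * g = g * a) :
    barChain G a g ∈ Z2 G := by
  simp only [Z2, LinearMap.mem_ker, barChain, map_sub, d2, Finsupp.lift_apply]
  rw [sum_single_index, sum_single_index] <;>
    simp [h, sub_add_eq_sub_sub]
  abel

/-- The homology class of the 2-cycle `[a|g] - [g|a]` (defined to be `0` if `a` and `g`
do not commute). -/
def barCls (G : Type*) [Group G] (a g : G) : H2 G :=
  open scoped Classical in
  if h : a * g = g * a then H2cls G (barChain G a g) (barChain_mem G a g h) else 0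

theorem d3_single (G : Type*) [Group G] (x y z : G) :
    d3 G (single (x, y, z) 1) =
      single (y, z) 1 - single (x * y, z) 1 + single (x, y * z) 1 - single (x, y) 1 := by
  simp [d3]

theorem barCls_of_commute {G : Type*} [Group G] {a g : G} (h : a * g = g * a) :
    barCls G a g = H2cls G (barChain G a g) (barChain_mem G a g h) :=
  dif_pos h

theorem barCls_self (G : Type*) [Group G] (a : G) : barCls G a a = 0 := by
  rw [barCls_of_commute rfl]
  exact (Submodule.Quotient.mk_eq_zero _).2 (by simp [B2, barChain])

/-- The class `cls([a|g] - [g|a])` is additive in `g ∈ C_G(a)`. -/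
theorem barCls_mul {G : Type*} [Group G] {a g h : G} (hg : a * g = g * a) (hh : a * h = h * a) :
    barCls G a (g * h) = barCls G a g + barCls G a h := by
  have hgh : a * (g * h) = g * h * a := by rw [← mul_assoc, hg, mul_assoc, hh, mul_assoc]
  rw [barCls_of_commute hg, barCls_of_commute hh, barCls_of_commute hgh]
  refine (Submodule.Quotient.eq _).2 ⟨single (a, g, h) 1 - single (g, a, h) 1 + single (g, h, a) 1,
    ?_⟩
  simp only [map_add, map_sub, d3_single, Submodule.subtype_apply, barChain, hg, hh]
  abel

/-- The homomorphism `C_G(a) → H₂G`, `g ↦ cls([a|g] - [g|a])`. -/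
def barClsHom {G : Type*} [Group G] (a : G) :
    Subgroup.centralizer {a} →* Multiplicative (H2 G) :=
  MonoidHom.mk' (fun g => Multiplicative.ofAdd (barCls G a g)) fun g h => by
    rw [Subgroup.coe_mul, barCls_mul (Subgroup.mem_centralizer_singleton_iff.1 g.2).symm
      (Subgroup.mem_centralizer_singleton_iff.1 h.2).symm, ofAdd_add]

theorem barCls_zpow_self {G : Type*} [Group G] (a : G) (n : ℤ) : barCls G a (a ^ n) = 0 := by
  have h := map_zpow (barClsHom a) ⟨a, Subgroup.mem_centralizer_singleton_iff.2 rfl⟩ n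
  have h' : barClsHom a ⟨a, Subgroup.mem_centralizer_singleton_iff.2 rfl⟩ = 1 := barCls_self G a
  rw [h', one_zpow] at h
  exact h

/-- Let `a ∈ G` and let `ε : G → ℤ` be a homomorphism with `ε(a) = 1`. Then every
`g ∈ C_G(a)` can be written as `g = g' aⁿ` with `g' ∈ C_G(a) ∩ Ker ε` and `n ∈ ℤ`, and
the homology classes in `H₂G` satisfy `cls([a|g] - [g|a]) = cls([a|g'] - [g'|a])`. -/
theorem barCls_reduction (G : Type u) [Group G] (a : G)
    (ε : G →* Multiplicative ℤ) (hεa : ε a = Multiplicative.ofAdd 1)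
    (g : G) (hg : g ∈ Subgroup.centralizer {a}) :
    ∃ (g' : G) (n : ℤ),
      g' ∈ Subgroup.centralizer {a} ∧ g' ∈ ε.ker ∧ g = g' * a ^ n ∧
      barCls G a g = barCls G a g' := by
  have hag : a * g = g * a := (Subgroup.mem_centralizer_singleton_iff.1 hg).symm
  let n : ℤ := (ε g).toAdd
  have hg' : a * (g * a ^ (-n)) = g * a ^ (-n) * a :=
    Commute.mul_right hag (Commute.self_zpow a (-n))
  have hn : g = g * a ^ (-n) * a ^ n := by simp
  refine ⟨g * a ^ (-n), n, Subgroup.mem_centralizer_singleton_iff.2 hg'.symm, ?_, hn, ?_⟩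
  · rw [MonoidHom.mem_ker, map_mul, map_zpow, hεa, ← ofAdd_zsmul]
    simp [n]
  · rw [barCls_mul hag (Commute.self_zpow a (-n)), barCls_zpow_self, add_zero]

end
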